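/- (Sign-segregation lemma) Let F(x) = f(x) + Σ_v g_v(x_v) + Σ_{(u,v)∈E} w_{(u,v)}|x_u − x_v| on a finite weighted graph G = (V,E,w) with w ≥ 0, f differentiable, and each g_v : ℝ → (-∞,+∞] directionally differentiable. Let x ∈ dom F. If there exists d ∈ ℝ^V with F'(x,d) < 0, then there exists d̃ ∈ ℝ^V with F'(x, d̃) < 0 which is sign-segregated over G, i.e., for every (u,v) ∈ E, sign(d̃_u) = sign(d̃_v) implies d̃_u = d̃_v. -/

import Mathlib

open Filter Set Finset

def HasDirDeriv {Ω : Type*} [AddCommGroup Ω] [Module ℝ Ω]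
    (h : Ω → EReal) (x d : Ω) (L : EReal) : Prop :=
  Tendsto (fun t : ℝ => ((t⁻¹ : ℝ) : EReal) * (h (x + t • d) - h x))
    (nhdsWithin 0 (Set.Ioi 0)) (nhds L)

variable {V : Type*} [Fintype V] [DecidableEq V]

/-- The objective `F = f + Σ_v g_v + graph total variation`. -/
noncomputable def objF (E : Finset (V × V)) (w : V × V → ℝ)
    (f : (V → ℝ) → ℝ) (g : V → ℝ → EReal) (x : V → ℝ) : EReal :=
  ((f x : ℝ) : EReal) + ∑ v, g v (x v) +
    ((∑ e ∈ E, w e * |x e.1 - x e.2| : ℝ) : EReal)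

/-- `δ⁺_v(x) = ∇_v f(x) + g_v'(x_v, +1) + Σ_{e ∋ v} w_e sign(x_v − x_u)`. -/
noncomputable def deltaPlus (E : Finset (V × V)) (w : V × V → ℝ)
    (f : (V → ℝ) → ℝ) (gd : V → ℝ → ℝ → EReal) (x : V → ℝ) (v : V) : EReal :=
  ((fderiv ℝ f x (Pi.single v 1) : ℝ) : EReal) + gd v (x v) 1 +
    ((∑ e ∈ E.filter (fun e => e.1 = v ∨ e.2 = v),
        w e * Real.sign (x v - x (if e.1 = v then e.2 else e.1)) : ℝ) : EReal)

/-- `δ⁻_v(x) = ∇_v f(x) − g_v'(x_v, −1) + Σ_{e ∋ v} w_e sign(x_v − x_u)`. -/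
noncomputable def deltaMinus (E : Finset (V × V)) (w : V × V → ℝ)
    (f : (V → ℝ) → ℝ) (gd : V → ℝ → ℝ → EReal) (x : V → ℝ) (v : V) : EReal :=
  ((fderiv ℝ f x (Pi.single v 1) : ℝ) : EReal) - gd v (x v) (-1) +
    ((∑ e ∈ E.filter (fun e => e.1 = v ∨ e.2 = v),
        w e * Real.sign (x v - x (if e.1 = v then e.2 else e.1)) : ℝ) : EReal)

/-- The value of the directional derivative of `F` at `x` in direction `d`. -/
noncomputable def dirDerivVal (E : Finset (V × V)) (w : V × V → ℝ)
    (f : (V → ℝ) → ℝ) (gd : V → ℝ → ℝ → EReal) (x d : V → ℝ) : EReal :=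
  (∑ v ∈ univ.filter (fun v => 0 < d v),
      ((d v : ℝ) : EReal) * deltaPlus E w f gd x v) +
  (∑ v ∈ univ.filter (fun v => d v < 0),
      ((d v : ℝ) : EReal) * deltaMinus E w f gd x v) +
  ((∑ e ∈ E.filter (fun e => x e.1 = x e.2), w e * |d e.1 - d e.2| : ℝ) : EReal)

theorem HasDirDeriv.unique {Ω : Type*} [AddCommGroup Ω] [Module ℝ Ω] {h : Ω → EReal}
    {x d : Ω} {L L' : EReal} (hL : HasDirDeriv h x d L) (hL' : HasDirDeriv h x d L') : L = L' :=
  tendsto_nhds_unique hL hL'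

theorem EReal.add_sub_add_comm_of_finite {a b c d : EReal} (hc : c ≠ ⊥) (hc' : c ≠ ⊤)
    (hd : d ≠ ⊥) (hd' : d ≠ ⊤) : a + b - (c + d) = (a - c) + (b - d) := by
  lift c to ℝ using ⟨hc', hc⟩
  lift d to ℝ using ⟨hd', hd⟩
  rw [sub_eq_add_neg, sub_eq_add_neg, sub_eq_add_neg, EReal.neg_add (by simp) (by simp),
    sub_eq_add_neg, add_add_add_comm]

theorem HasDirDeriv.add {Ω : Type*} [AddCommGroup Ω] [Module ℝ Ω] {h k : Ω → EReal}
    {x d : Ω} {L M : EReal} (hh : HasDirDeriv h x d L) (hk : HasDirDeriv k x d M)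
    (hx : h x ≠ ⊥) (hx' : h x ≠ ⊤) (kx : k x ≠ ⊥) (kx' : k x ≠ ⊤) (hL : L ≠ ⊥) (hM : M ≠ ⊥) :
    HasDirDeriv (fun y => h y + k y) x d (L + M) := by
  have key := (EReal.continuousAt_add (p := (L, M)) (.inr hM) (.inl hL)).tendsto.comp
    (hh.prodMk_nhds hk)
  refine key.congr' ?_
  filter_upwards [self_mem_nhdsWithin] with t ht
  have ht' : (0 : EReal) ≤ ((t⁻¹ : ℝ) : EReal) := by
    exact_mod_cast (inv_pos.2 ht).le
  simp only [Function.comp_apply]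
  rw [EReal.add_sub_add_comm_of_finite hx hx' kx kx',
    EReal.left_distrib_of_nonneg_of_ne_top ht' (EReal.coe_ne_top _)]

theorem EReal.sum_ne_bot {ι : Type*} {s : Finset ι} {a : ι → EReal} (h : ∀ i ∈ s, a i ≠ ⊥) :
    ∑ i ∈ s, a i ≠ ⊥ :=
  Finset.sum_induction a (· ≠ ⊥) (fun _ _ ha hb => EReal.add_ne_bot_iff.2 ⟨ha, hb⟩)
    EReal.zero_ne_bot h

theorem EReal.ne_top_of_sum_ne_top {ι : Type*} [DecidableEq ι] {s : Finset ι} {a : ι → EReal}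
    (h : ∀ i ∈ s, a i ≠ ⊥) (hs : ∑ i ∈ s, a i ≠ ⊤) : ∀ i ∈ s, a i ≠ ⊤ := by
  intro i hi
  rw [← Finset.add_sum_erase s a hi] at hs
  exact ((EReal.add_ne_top_iff_ne_top₂ (h i hi)
    (EReal.sum_ne_bot fun j hj => h j (Finset.mem_of_mem_erase hj))).1 hs).1

theorem EReal.sum_eq_coe_sum_toReal {ι : Type*} {s : Finset ι} {a : ι → EReal}
    (h : ∀ i ∈ s, a i ≠ ⊥) (h' : ∀ i ∈ s, a i ≠ ⊤) :
    ∑ i ∈ s, a i = ((∑ i ∈ s, (a i).toReal : ℝ) : EReal) := by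
  classical
  induction s using Finset.induction_on with
  | empty => simp
  | insert i s hi ih =>
    rw [Finset.sum_insert hi, Finset.sum_insert hi, EReal.coe_add,
      EReal.coe_toReal (h' i (by simp)) (h i (by simp)),
      ih (fun j hj => h j (by simp [hj])) (fun j hj => h' j (by simp [hj]))]

theorem hasDirDeriv_coe_iff {Ω : Type*} [AddCommGroup Ω] [Module ℝ Ω] {f : Ω → ℝ} {x d : Ω}
    {L : ℝ} : HasDirDeriv (fun y => (f y : EReal)) x d L ↔
      Tendsto (fun t : ℝ => t⁻¹ * (f (x + t • d) - f x)) (nhdsWithin 0 (Set.Ioi 0)) (nhds L) := by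
  simp only [HasDirDeriv, ← EReal.coe_sub, ← EReal.coe_mul, EReal.tendsto_coe]

theorem hasDirDeriv_sum {Ω ι : Type*} [AddCommGroup Ω] [Module ℝ Ω] (s : Finset ι)
    {h : ι → Ω → EReal} {x d : Ω} {L : ι → EReal} (hh : ∀ i ∈ s, HasDirDeriv (h i) x d (L i))
    (hx : ∀ i ∈ s, h i x ≠ ⊥) (hx' : ∀ i ∈ s, h i x ≠ ⊤) (hL : ∀ i ∈ s, L i ≠ ⊥) :
    HasDirDeriv (fun y => ∑ i ∈ s, h i y) x d (∑ i ∈ s, L i) := by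
  classical
  induction s using Finset.induction_on with
  | empty => simp [HasDirDeriv]
  | insert i s hi ih =>
    simp only [Finset.sum_insert hi]
    have hb : ∀ j ∈ s, h j x ≠ ⊥ := fun j hj => hx j (by simp [hj])
    have ht : ∀ j ∈ s, h j x ≠ ⊤ := fun j hj => hx' j (by simp [hj])
    have hLs : ∀ j ∈ s, L j ≠ ⊥ := fun j hj => hL j (by simp [hj])
    refine (hh i (by simp)).add (ih (fun j hj => hh j (by simp [hj])) hb ht hLs)
      (hx i (by simp)) (hx' i (by simp)) (EReal.sum_ne_bot hb) ?_ (hL i (by simp))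
      (EReal.sum_ne_bot hLs)
    rw [EReal.sum_eq_coe_sum_toReal hb ht]
    exact EReal.coe_ne_top _

theorem HasDirDeriv.const_smul {Ω : Type*} [AddCommGroup Ω] [Module ℝ Ω] {h : Ω → EReal}
    {x d : Ω} {L : EReal} (hh : HasDirDeriv h x d L) {c : ℝ} (hc : 0 < c) :
    HasDirDeriv h x (c • d) (c * L) := by
  have hlim : Tendsto (fun t : ℝ => t * c) (nhdsWithin 0 (Set.Ioi 0))
      (nhdsWithin 0 (Set.Ioi 0)) := by
    refine tendsto_nhdsWithin_iff.2 ⟨?_, ?_⟩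
    · exact (Continuous.tendsto' (by fun_prop) 0 0 (by simp)).mono_left nhdsWithin_le_nhds
    · filter_upwards [self_mem_nhdsWithin] with t ht
      exact mul_pos ht hc
  have key := EReal.Tendsto.const_mul (a := (c : EReal)) (hh.comp hlim)
    (.inl (EReal.coe_ne_bot c)) (.inl (EReal.coe_ne_top c))
  refine key.congr fun t => ?_
  simp only [Function.comp_apply]
  rw [← mul_assoc, ← EReal.coe_mul, smul_smul]
  congr 2
  field_simp

/-- The one-sided derivative at `0` of `t ↦ |a + t * b|`. -/
noncomputable def absDirDeriv (a b : ℝ) : ℝ :=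
  if a = 0 then |b| else SignType.sign a * b

theorem tendsto_slope_abs (a b : ℝ) :
    Tendsto (fun t : ℝ => t⁻¹ * (|a + t * b| - |a|)) (nhdsWithin 0 (Set.Ioi 0))
      (nhds (absDirDeriv a b)) := by
  unfold absDirDeriv
  split_ifs with ha
  · refine tendsto_const_nhds.congr' ?_
    filter_upwards [self_mem_nhdsWithin] with t ht
    have ht : (0 : ℝ) < t := ht
    rw [ha, zero_add, abs_zero, sub_zero, abs_mul, abs_of_pos ht]
    field_simp
  · have h : HasLineDerivAt ℝ (fun y : ℝ => |y|) (SignType.sign a * b) a b := by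
      simpa [mul_comm] using (hasDerivAt_abs ha).hasFDerivAt.hasLineDerivAt b
    exact h.tendsto_slope_zero_right

theorem absDirDeriv_add {a b c : ℝ} (h : |b + c| = |b| + |c|) :
    absDirDeriv a (b + c) = absDirDeriv a b + absDirDeriv a c := by
  unfold absDirDeriv
  split_ifs
  · exact h
  · ring

theorem abs_sub_eq_of_truncation {m a b p q : ℝ}
    (ha : (0 < m ∧ m ≤ a ∧ p = m) ∨ (0 < m ∧ a ≤ 0 ∧ p = 0) ∨
      (m < 0 ∧ a ≤ m ∧ p = m) ∨ (m < 0 ∧ 0 ≤ a ∧ p = 0))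
    (hb : (0 < m ∧ m ≤ b ∧ q = m) ∨ (0 < m ∧ b ≤ 0 ∧ q = 0) ∨
      (m < 0 ∧ b ≤ m ∧ q = m) ∨ (m < 0 ∧ 0 ≤ b ∧ q = 0)) :
    |a - b| = |p - q| + |a - p - (b - q)| := by
  grind

/-- A strict descent direction for a functional which is additive along order-compatible
rescalings can be replaced by one constant on each sign class. -/
theorem exists_sign_constant_neg {V : Type*} [Fintype V] (S : Set (V → ℝ)) (H : (V → ℝ) → ℝ)
    (hzero : H 0 = 0)
    (hadd : ∀ d ∈ S, ∀ c : V → ℝ, (∀ u, 0 ≤ c u) → (∀ u, c u ≤ 1) →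
      (∀ u v, |d u - d v| = |c u * d u - c v * d v| + |(1 - c u) * d u - (1 - c v) * d v|) →
      c * d ∈ S ∧ (1 - c) * d ∈ S ∧ H d = H (c * d) + H ((1 - c) * d))
    (d : V → ℝ) (hd : d ∈ S) (hneg : H d < 0) :
    ∃ d' ∈ S, H d' < 0 ∧ ∀ u v, Real.sign (d' u) = Real.sign (d' v) → d' u = d' v := by
  classical
  induction hn : #{u | d u ≠ 0} using Nat.strong_induction_on generalizing d with
  | _ n ih =>
  obtain hempty | hne := (Finset.univ.filter fun u => d u ≠ 0).eq_empty_or_nonempty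
  · have : d = 0 := by
      ext u
      by_contra hu
      have : u ∈ Finset.univ.filter fun u => d u ≠ 0 := by simpa using hu
      simp [hempty] at this
    rw [this, hzero] at hneg
    exact absurd hneg (lt_irrefl _)
  obtain ⟨v, hv, hmin⟩ := Finset.exists_min_image _ (fun u => |d u|) hne
  have hv0 : d v ≠ 0 := by simpa using hv
  replace hmin : ∀ u, d u ≠ 0 → |d v| ≤ |d u| := fun u hu => hmin u (by simpa using hu)
  let c : V → ℝ := fun u => if 0 < d v * d u then d v / d u else 0
  have hcpos : ∀ u, 0 < d v * d u → c u * d u = d v := by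
    intro u hu
    have : d u ≠ 0 := by rintro h; simp [h] at hu
    simp [c, hu, this]
  have hcneg : ∀ u, ¬ 0 < d v * d u → c u = 0 := fun u hu => by simp [c, hu]
  have hc0 : ∀ u, 0 ≤ c u := by
    intro u
    by_cases hu : 0 < d v * d u
    · simp only [c, if_pos hu]
      exact (div_pos_iff.2 (mul_pos_iff.1 hu)).le
    · rw [hcneg u hu]
  have hc1 : ∀ u, c u ≤ 1 := by
    intro u
    by_cases hu : 0 < d v * d u
    · have hu0 : d u ≠ 0 := by rintro h; simp [h] at hu
      refine le_trans (le_abs_self _) ?_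
      simp only [c, if_pos hu, abs_div]
      exact div_le_one_of_le₀ (hmin u hu0) (abs_nonneg _)
    · rw [hcneg u hu]
      exact zero_le_one
  have hcases : ∀ u, (0 < d v ∧ d v ≤ d u ∧ c u * d u = d v) ∨
      (0 < d v ∧ d u ≤ 0 ∧ c u * d u = 0) ∨ (d v < 0 ∧ d u ≤ d v ∧ c u * d u = d v) ∨
      (d v < 0 ∧ 0 ≤ d u ∧ c u * d u = 0) := by
    intro u
    by_cases hu : 0 < d v * d u
    · have hu0 : d u ≠ 0 := by rintro h; simp [h] at hu
      have hm := hmin u hu0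
      obtain ⟨h1, h2⟩ | ⟨h1, h2⟩ := mul_pos_iff.1 hu
      · rw [abs_of_pos h1, abs_of_pos h2] at hm
        exact .inl ⟨h1, hm, hcpos u hu⟩
      · rw [abs_of_neg h1, abs_of_neg h2] at hm
        exact .inr (.inr (.inl ⟨h1, by linarith, hcpos u hu⟩))
    · have hz : c u * d u = 0 := by rw [hcneg u hu, zero_mul]
      obtain h1 | h1 := hv0.lt_or_gt
      · exact .inr (.inr (.inr ⟨h1, by by_contra! h; exact hu (mul_pos_of_neg_of_neg h1 h), hz⟩))
      · exact .inr (.inl ⟨h1, by by_contra! h; exact hu (mul_pos h1 h), hz⟩)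
  obtain ⟨hS₁, hS₂, hsum⟩ := hadd d hd c hc0 hc1 (by
    intro a b
    rw [sub_mul, sub_mul, one_mul, one_mul]
    exact abs_sub_eq_of_truncation (hcases a) (hcases b))
  by_cases hlt : H (c * d) < 0
  · refine ⟨c * d, hS₁, hlt, fun a b hab => ?_⟩
    simp only [Pi.mul_apply] at hab ⊢
    obtain ha | ha : c a * d a = d v ∨ c a * d a = 0 := by grind
    all_goals obtain hb | hb : c b * d b = d v ∨ c b * d b = 0 := by grind
    all_goals rw [ha, hb] at hab ⊢
    · rw [Real.sign_zero, Real.sign_eq_zero_iff] at hab; exact hab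
    · rw [Real.sign_zero, eq_comm, Real.sign_eq_zero_iff] at hab; exact hab.symm
  · refine ih _ ?_ ((1 - c) * d) hS₂ (by linarith) rfl
    rw [← hn]
    refine Finset.card_lt_card ⟨fun u => ?_, fun hsub => ?_⟩
    · simp only [Finset.mem_filter_univ, Pi.mul_apply]
      exact right_ne_zero_of_mul
    · have := hsub hv
      have hcv : c v = 1 := by simp [c, hv0, mul_self_pos.2 hv0]
      simp [hcv] at this

theorem hasDirDeriv_totalVariation {V : Type*} (E : Finset (V × V)) (w : V × V → ℝ)
    (x d : V → ℝ) :
    HasDirDeriv (fun y : V → ℝ => ((∑ e ∈ E, w e * |y e.1 - y e.2| : ℝ) : EReal)) x d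
      ((∑ e ∈ E, w e * absDirDeriv (x e.1 - x e.2) (d e.1 - d e.2) : ℝ) : EReal) := by
  rw [hasDirDeriv_coe_iff]
  have hlim := tendsto_finsetSum E fun e _ =>
    (tendsto_slope_abs (x e.1 - x e.2) (d e.1 - d e.2)).const_mul (w e)
  refine hlim.congr fun t => ?_
  rw [← Finset.sum_sub_distrib, Finset.mul_sum]
  refine Finset.sum_congr rfl fun e _ => ?_
  simp only [Pi.add_apply, Pi.smul_apply, smul_eq_mul]
  rw [show x e.1 + t * d e.1 - (x e.2 + t * d e.2) = x e.1 - x e.2 + t * (d e.1 - d e.2) by ring]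
  ring

theorem HasDirDeriv.comp_apply {V : Type*} {h : ℝ → EReal} {x d : V → ℝ} {v : V} {L : EReal}
    (hh : HasDirDeriv h (x v) (d v) L) : HasDirDeriv (fun y : V → ℝ => h (y v)) x d L := by
  simpa only [HasDirDeriv, Pi.add_apply, Pi.smul_apply] using hh

theorem hasDirDeriv_separable {V : Type*} [Fintype V] {g : V → ℝ → EReal} {x d : V → ℝ}
    {G : V → EReal} (hbot : ∀ v, g v (x v) ≠ ⊥) (htop : ∀ v, g v (x v) ≠ ⊤)
    (hG : ∀ v, HasDirDeriv (g v) (x v) (d v) (G v)) (hGbot : ∀ v, G v ≠ ⊥) :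
    HasDirDeriv (fun y : V → ℝ => ∑ v, g v (y v)) x d (∑ v, G v) := by
  have hcoord : ∀ v ∈ Finset.univ, HasDirDeriv (fun y : V → ℝ => g v (y v)) x d (G v) :=
    fun v _ => (hG v).comp_apply
  exact hasDirDeriv_sum Finset.univ hcoord (fun v _ => hbot v) (fun v _ => htop v)
    fun v _ => hGbot v

theorem hasDirDeriv_objF {V : Type*} [Fintype V] (E : Finset (V × V)) (w : V × V → ℝ)
    {f : (V → ℝ) → ℝ} (hf : Differentiable ℝ f) {g : V → ℝ → EReal} {x d : V → ℝ}
    {G : V → EReal} (hbot : ∀ v, g v (x v) ≠ ⊥) (htop : ∀ v, g v (x v) ≠ ⊤)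
    (hG : ∀ v, HasDirDeriv (g v) (x v) (d v) (G v)) (hGbot : ∀ v, G v ≠ ⊥) :
    HasDirDeriv (objF E w f g) x d (((fderiv ℝ f x d : ℝ) : EReal) + ∑ v, G v +
      ((∑ e ∈ E, w e * absDirDeriv (x e.1 - x e.2) (d e.1 - d e.2) : ℝ) : EReal)) := by
  have hfd : HasDirDeriv (fun y => (f y : EReal)) x d ((fderiv ℝ f x d : ℝ) : EReal) :=
    hasDirDeriv_coe_iff.2 ((hf x).hasFDerivAt.hasLineDerivAt d).tendsto_slope_zero_right
  have hgd := hasDirDeriv_separable hbot htop hG hGbot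
  have htv := hasDirDeriv_totalVariation E w x d
  have hsb := EReal.sum_ne_bot (s := Finset.univ) fun v _ => hbot v
  have hst : ∑ v, g v (x v) ≠ ⊤ := by
    rw [EReal.sum_eq_coe_sum_toReal (fun v _ => hbot v) fun v _ => htop v]
    exact EReal.coe_ne_top _
  have hGs := EReal.sum_ne_bot (s := Finset.univ) fun v _ => hGbot v
  have hfg := hfd.add hgd (EReal.coe_ne_bot _) (EReal.coe_ne_top _) hsb hst (EReal.coe_ne_bot _)
    hGs
  exact hfg.add htv (EReal.add_ne_bot_iff.2 ⟨EReal.coe_ne_bot _, hsb⟩)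
    (EReal.add_ne_top (EReal.coe_ne_top _) hst) (EReal.coe_ne_bot _) (EReal.coe_ne_top _)
    (EReal.add_ne_bot_iff.2 ⟨EReal.coe_ne_bot _, hGs⟩) (EReal.coe_ne_bot _)

theorem stmt_12 (E : Finset (V × V)) (w : V × V → ℝ) (hw : ∀ e ∈ E, 0 ≤ w e)
    (f : (V → ℝ) → ℝ) (hf : Differentiable ℝ f)
    (g : V → ℝ → EReal) (hgbot : ∀ v y, g v y ≠ ⊥)
    (gd : V → ℝ → ℝ → EReal)
    (hgd : ∀ v y, g v y ≠ ⊤ → ∀ dir : ℝ,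
      HasDirDeriv (g v) y dir (gd v y dir) ∧ gd v y dir ≠ ⊥)
    (x : V → ℝ) (hx : objF E w f g x ≠ ⊤)
    (hdesc : ∃ d : V → ℝ, ∃ L : EReal,
      HasDirDeriv (objF E w f g) x d L ∧ L < 0) :
    ∃ d : V → ℝ, (∀ e ∈ E, Real.sign (d e.1) = Real.sign (d e.2) → d e.1 = d e.2) ∧
      ∃ L : EReal, HasDirDeriv (objF E w f g) x d L ∧ L < 0 := by
  have hxsum : ∑ v, g v (x v) ≠ ⊤ := fun h => hx (by
    rw [objF, h, EReal.coe_add_top, EReal.top_add_coe])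
  have htop : ∀ v, g v (x v) ≠ ⊤ := fun v =>
    EReal.ne_top_of_sum_ne_top (fun v _ => hgbot v (x v)) hxsum v (Finset.mem_univ v)
  have hG := fun v => hgd v (x v) (htop v)
  have hsmul : ∀ v a c, 0 ≤ c → gd v (x v) (c * a) = (c : EReal) * gd v (x v) a := by
    intro v a c hc
    obtain rfl | hc := hc.eq_or_lt
    · rw [zero_mul, EReal.coe_zero, zero_mul]
      exact (hG v 0).1.unique (by
        simp [HasDirDeriv, EReal.sub_self (htop v) (hgbot v _)])
    · exact (hG v (c * a)).1.unique ((hG v a).1.const_smul hc)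
  have hF := fun d : V → ℝ => hasDirDeriv_objF E w hf (d := d) (fun v => hgbot v (x v)) htop
    (fun v => (hG v (d v)).1) fun v => (hG v (d v)).2
  let S : Set (V → ℝ) := {d | ∀ v, gd v (x v) (d v) ≠ ⊤}
  let H : (V → ℝ) → ℝ := fun d => fderiv ℝ f x d + ∑ v, (gd v (x v) (d v)).toReal +
    ∑ e ∈ E, w e * absDirDeriv (x e.1 - x e.2) (d e.1 - d e.2)
  have hFS : ∀ d ∈ S, HasDirDeriv (objF E w f g) x d (H d) := by
    intro d hd
    have := hF d
    rwa [EReal.sum_eq_coe_sum_toReal (fun v _ => (hG v (d v)).2) fun v _ => hd v,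
      ← EReal.coe_add, ← EReal.coe_add] at this
  have hS : ∀ d ∈ S, ∀ c : V → ℝ, (∀ u, 0 ≤ c u) → c * d ∈ S := by
    intro d hd c hc v
    rw [Pi.mul_apply, hsmul v _ _ (hc v), ← EReal.coe_toReal (hd v) (hG v (d v)).2,
      ← EReal.coe_mul]
    exact EReal.coe_ne_top _
  have hzero : H 0 = 0 := by
    have h0 : ∀ v, gd v (x v) 0 = 0 := fun v => by simpa using hsmul v 0 0 le_rfl
    simp [H, h0, absDirDeriv]
  obtain ⟨d, L, hL, hneg⟩ := hdesc
  have hdS : d ∈ S := by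
    refine fun v => EReal.ne_top_of_sum_ne_top (fun v _ => (hG v (d v)).2) (fun h => ?_) v
      (Finset.mem_univ v)
    have hLF := hL.unique (hF d)
    rw [h, EReal.coe_add_top, EReal.top_add_coe] at hLF
    simp [hLF] at hneg
  have hdneg : H d < 0 := by
    rw [hL.unique (hFS d hdS)] at hneg
    exact_mod_cast hneg
  obtain ⟨d', hS', hneg', hseg⟩ := exists_sign_constant_neg S H hzero (fun d hd c hc0 hc1 habs => by
    refine ⟨hS d hd c hc0, hS d hd (1 - c) fun u => sub_nonneg.2 (hc1 u), ?_⟩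
    have hlin : fderiv ℝ f x d = fderiv ℝ f x (c * d) + fderiv ℝ f x ((1 - c) * d) := by
      rw [← map_add]
      congr 1
      ring
    have hg : ∀ v, (gd v (x v) (d v)).toReal = (gd v (x v) ((c * d) v)).toReal +
        (gd v (x v) (((1 - c) * d) v)).toReal := by
      intro v
      have h1 : 0 ≤ (1 - c) v := sub_nonneg.2 (hc1 v)
      rw [Pi.mul_apply, Pi.mul_apply, hsmul v _ _ (hc0 v), hsmul v _ _ h1, EReal.toReal_mul,
        EReal.toReal_mul, EReal.toReal_coe, EReal.toReal_coe, Pi.sub_apply, Pi.one_apply]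
      ring
    have htv : ∀ e : V × V, absDirDeriv (x e.1 - x e.2) (d e.1 - d e.2) =
        absDirDeriv (x e.1 - x e.2) ((c * d) e.1 - (c * d) e.2) +
          absDirDeriv (x e.1 - x e.2) (((1 - c) * d) e.1 - ((1 - c) * d) e.2) := by
      intro e
      have hsplit : d e.1 - d e.2 = ((c * d) e.1 - (c * d) e.2) +
          (((1 - c) * d) e.1 - ((1 - c) * d) e.2) := by
        simp only [Pi.mul_apply, Pi.sub_apply, Pi.one_apply]
        ring
      rw [← absDirDeriv_add, ← hsplit]
      rw [← hsplit]
      exact habs e.1 e.2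
    simp only [H, hlin, hg, htv, mul_add, Finset.sum_add_distrib]
    ring) d hdS hdneg
  exact ⟨d', fun e _ => hseg e.1 e.2, H d', hFS d' hS', by exact_mod_cast hneg'⟩
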